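/- Let ψ : P^{m}_k ⇢ P^{n}_k be a rational map defined by forms f_0, ..., f_n of the same degree, defined on the complement Ω of its base locus, and let J(f) be the (n+1) × (m+1) Jacobian matrix of the f_i. Suppose V is an irreducible subvariety of P^m_k with V ∩ Ω ≠ ∅ and set r = dim V − dim ψ(V). Then V is contained in the vanishing locus of the ideal I_{m−r+2}(J(f)) generated by the (m−r+2)-minors of J(f). -/

import Mathlib

open MvPolynomial

attribute [local instance] MvPolynomial.gradedAlgebra

noncomputable section

variable {k : Type} [Field k] {m n d : ℕ}

/-- The Jacobian matrix `J(f)` of the forms `f₀,…,f_n ∈ k[x₀,…,x_m]`, with entries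
`∂fᵢ/∂xⱼ`. -/
def jacMat (f : Fin (n + 1) → MvPolynomial (Fin (m + 1)) k) :
    Matrix (Fin (n + 1)) (Fin (m + 1)) (MvPolynomial (Fin (m + 1)) k) :=
  fun i j => pderiv j (f i)

/-- The determinantal ideal `I_s(J(f))` generated by the `s × s` minors of the Jacobian
matrix. -/
def jacMinors (f : Fin (n + 1) → MvPolynomial (Fin (m + 1)) k) (s : ℕ) :
    Ideal (MvPolynomial (Fin (m + 1)) k) :=
  Ideal.span { q | ∃ (g : Fin s → Fin (n + 1)) (h : Fin s → Fin (m + 1)),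
    q = Matrix.det ((jacMat f).submatrix g h) }

/-- Integral injective extensions preserve Krull dimension. -/
theorem ringKrullDim_eq_of_isIntegral (R S : Type*) [CommRing R] [CommRing S] [Algebra R S]
    [Algebra.IsIntegral R S] [FaithfulSMul R S] : ringKrullDim S = ringKrullDim R := by
  refine le_antisymm (Order.krullDim_le_of_strictMono (PrimeSpectrum.comap (algebraMap R S))
    fun I J hIJ ↦ Ideal.IsIntegral.comap_lt_comap (R := R) hIJ) (iSup_le fun l ↦ ?_)
  obtain ⟨P, hP, hPl⟩ := Ideal.nonempty_primesOver (S := S) l.head.asIdeal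
  obtain ⟨L, hL, -⟩ := Ideal.exists_ltSeries_of_hasGoingUp (S := S) l P
  exact hL ▸ Order.LTSeries.length_le_krullDim L

/-- The Krull dimension of a finitely generated domain over a field is its transcendence
degree. -/
theorem trdeg_eq_of_ringKrullDim_eq (F A : Type*) [Field F] [CommRing A] [IsDomain A] [Algebra F A]
    [Algebra.FiniteType F A] {s : ℕ} (hs : ringKrullDim A = s) : Algebra.trdeg F A = s := by
  obtain ⟨t, g, hg, hint⟩ := exists_integral_inj_algHom_of_fg F A
  algebraize [g.toRingHom]
  have : FaithfulSMul (MvPolynomial (Fin t) F) A :=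
    (faithfulSMul_iff_algebraMap_injective _ _).mpr hg
  have : Algebra.IsIntegral (MvPolynomial (Fin t) F) A := ⟨hint⟩
  have hdim := ringKrullDim_eq_of_isIntegral (MvPolynomial (Fin t) F) A
  rw [hs, MvPolynomial.ringKrullDim_of_isNoetherianRing, ringKrullDim_eq_zero_of_field, zero_add,
    Nat.card_fin] at hdim
  have hst : s = t := by exact_mod_cast hdim
  have h := lift_trdeg_add_eq F (MvPolynomial (Fin t) F) A
  rw [MvPolynomial.trdeg_of_isDomain, trdeg_eq_zero] at h
  simpa [hst] using h.symm

open scoped IntermediateField.algebraAdjoinAdjoin in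
/-- The transcendence degree of a finitely generated field extension is at most the dimension of
its module of Kähler differentials. -/
theorem trdeg_le_rank_kaehlerDifferential (K L : Type*) [Field K] [Field L]
    [Algebra K L] [Algebra.EssFiniteType K L] :
    Algebra.trdeg K L ≤ Module.rank L (Ω[L⁄K]) := by
  have hspan := (KaehlerDifferential.span_range_derivation K L).ge
  let b := Module.Basis.ofSpan hspan
  have hb (i) : ∃ z, KaehlerDifferential.D K L z = b i :=
    Module.Basis.ofSpan_subset hspan ⟨i, rfl⟩
  choose z hz using hb
  let E := IntermediateField.adjoin K (Set.range z)
  have : Subsingleton (Ω[L⁄E]) := by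
    have hmap : KaehlerDifferential.map K E L L = 0 := b.ext fun i ↦ by
      rw [← hz, KaehlerDifferential.map_D]
      exact (KaehlerDifferential.D E L).map_algebraMap
        ⟨z i, IntermediateField.subset_adjoin K _ ⟨i, rfl⟩⟩
    refine subsingleton_of_forall_eq 0 fun w ↦ ?_
    obtain ⟨v, rfl⟩ := KaehlerDifferential.map_surjective K E L w
    rw [hmap, LinearMap.zero_apply]
  have : Algebra.FormallyUnramified E L := ⟨this⟩
  have : Algebra.EssFiniteType E L := .of_comp K E L
  have : Algebra.IsSeparable E L := (Algebra.FormallyUnramified.iff_isSeparable E L).mp ‹_›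
  have : Algebra.IsAlgebraic (Algebra.adjoin K (Set.range z)) L :=
    .trans (Algebra.adjoin K (Set.range z)) E L
  exact (Algebra.IsAlgebraic.trdeg_le_cardinalMk K (Set.range z)).trans
    (Cardinal.mk_range_le.trans b.mk_eq_rank''.le)

open scoped IntermediateField.algebraAdjoinAdjoin in
/-- Additivity of transcendence degrees over the subfield generated by finitely many elements,
with the Krull dimension of the algebra they generate. -/
theorem natCast_sub_le_trdeg_adjoin {F L ι : Type*} [Field F] [Field L] [Algebra F L] [Finite ι]
    {y : ι → L} {a b : ℕ} (ha : Algebra.trdeg F L = a)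
    (hb : ringKrullDim (Algebra.adjoin F (Set.range y)) = b) :
    ((a - b : ℕ) : Cardinal) ≤ Algebra.trdeg (IntermediateField.adjoin F (Set.range y)) L := by
  have : Algebra.FiniteType F (Algebra.adjoin F (Set.range y)) :=
    .adjoin_of_finite (Set.finite_range y)
  have hFK := trdeg_add_eq F (Algebra.adjoin F (Set.range y))
    (A := IntermediateField.adjoin F (Set.range y))
  have hFL := trdeg_add_eq F (IntermediateField.adjoin F (Set.range y)) (A := L)
  rw [trdeg_eq_of_ringKrullDim_eq F _ hb, trdeg_eq_zero, add_zero] at hFK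
  rw [← hFK, ha] at hFL
  obtain ⟨t, ht⟩ := Cardinal.lt_aleph0.mp
    ((le_add_self.trans hFL.le).trans_lt Cardinal.natCast_lt_aleph0)
  rw [ht] at hFL ⊢
  norm_cast at hFL ⊢
  lia

/-- The chain rule for derivations along the evaluation of a polynomial. -/
theorem Derivation.map_mvPolynomial_aeval {R A M σ : Type*} [CommRing R] [CommRing A] [Algebra R A]
    [AddCommGroup M] [Module A M] [Module R M] [Fintype σ] (D : Derivation R A M) (x : σ → A)
    (p : MvPolynomial σ R) :
    D (aeval x p) = ∑ j, aeval x (pderiv j p) • D (x j) := by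
  classical
  induction p using MvPolynomial.induction_on with
  | C a => simp
  | add p q hp hq => simp [hp, hq, add_smul, Finset.sum_add_distrib]
  | mul_X p i h =>
    have hite (j : σ) : aeval x (if i = j then p else 0) • D (x j) =
        if i = j then aeval x p • D (x j) else 0 := by split_ifs <;> simp
    simp [h, pderiv_X, Pi.single_apply, add_smul, Finset.sum_add_distrib, Finset.smul_sum,
      mul_smul, hite]

/-- Differentials of field generators span the module of Kähler differentials. -/
theorem span_range_D_eq_top_of_adjoin_eq_top {K L σ : Type*} [Field K] [Field L] [Algebra K L]
    {x : σ → L} (hx : IntermediateField.adjoin K (Set.range x) = ⊤) :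
    Submodule.span L (Set.range fun j ↦ KaehlerDifferential.D K L (x j)) = ⊤ := by
  rw [← top_le_iff, ← KaehlerDifferential.span_range_derivation, Submodule.span_le]
  rintro _ ⟨z, rfl⟩
  have hz : z ∈ IntermediateField.adjoin K (Set.range x) := hx ▸ IntermediateField.mem_top
  induction hz using IntermediateField.adjoin_induction with
  | mem z hz =>
    obtain ⟨j, rfl⟩ := hz
    exact Submodule.subset_span ⟨j, rfl⟩
  | algebraMap c => simp
  | add a b _ _ ha hb => simpa using add_mem ha hb
  | inv a _ ha =>
    rw [Derivation.leibniz_inv]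
    exact Submodule.smul_mem _ _ ha
  | mul a b _ _ ha hb =>
    rw [Derivation.leibniz]
    exact add_mem (Submodule.smul_mem _ _ hb) (Submodule.smul_mem _ _ ha)

/-- If `L` is generated over `F` by elements `xⱼ`, `j ∈ σ`, and has transcendence degree at
least `r` over the subfield generated by the `fᵢ(x)`, then the minors of size `> #σ - r` of the Jacobian matrix
of `f` vanish at `x`. -/
theorem det_jacobian_submatrix_eq_zero {F L σ τ : Type*} [Field F] [Field L] [Algebra F L]
    [Fintype σ] {x : σ → L} (hx : IntermediateField.adjoin F (Set.range x) = ⊤)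
    (f : τ → MvPolynomial σ F) {r s : ℕ}
    (hr : r ≤ Algebra.trdeg (IntermediateField.adjoin F (Set.range fun i ↦ aeval x (f i))) L)
    (hs : Fintype.card σ < s + r) (g : Fin s → τ) (h : Fin s → σ) :
    ((Matrix.of fun i j ↦ aeval x (pderiv j (f i))).submatrix g h).det = 0 := by
  set K := IntermediateField.adjoin F (Set.range fun i ↦ aeval x (f i))
  have : Algebra.EssFiniteType F L := IntermediateField.fg_top_iff.mp
    (hx ▸ IntermediateField.fg_adjoin_of_finite (Set.finite_range x))
  have : Algebra.EssFiniteType K L := .of_comp F K L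
  have hxK : IntermediateField.adjoin K (Set.range x) = ⊤ := by
    have hle : IntermediateField.adjoin F (Set.range x) ≤
        (IntermediateField.adjoin K (Set.range x)).restrictScalars F :=
      IntermediateField.adjoin_le_iff.mpr (IntermediateField.subset_adjoin K _)
    rw [← top_le_iff]
    intro z _
    exact hle (hx ▸ IntermediateField.mem_top)
  let φ : (σ → L) →ₗ[L] Ω[L⁄K] :=
    Fintype.linearCombination L fun j ↦ KaehlerDifferential.D K L (x j)
  have hφ : LinearMap.range φ = ⊤ := by
    rw [Fintype.range_linearCombination, span_range_D_eq_top_of_adjoin_eq_top hxK]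
  have hrank : r ≤ Module.finrank L (Ω[L⁄K]) := by
    have := hr.trans (trdeg_le_rank_kaehlerDifferential K L)
    rw [← Module.finrank_eq_rank] at this
    exact_mod_cast this
  have hker := φ.finrank_range_add_finrank_ker
  rw [hφ, finrank_top, Module.finrank_fintype_fun_eq_card] at hker
  by_contra hdet
  have hind : LinearIndependent L fun (a : Fin s) j ↦ aeval x (pderiv j (f (g a))) :=
    (Matrix.linearIndependent_rows_of_det_ne_zero hdet).of_comp (LinearMap.funLeft L L h)
  have hmem (a : Fin s) : (fun j ↦ aeval x (pderiv j (f (g a)))) ∈ LinearMap.ker φ := by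
    rw [LinearMap.mem_ker, Fintype.linearCombination_apply]
    exact (Derivation.map_mvPolynomial_aeval ((KaehlerDifferential.D K L).restrictScalars F) x
      (f (g a))).symm.trans <| (KaehlerDifferential.D K L).map_algebraMap
        ⟨aeval x (f (g a)), IntermediateField.subset_adjoin F _ ⟨g a, rfl⟩⟩
  have hind' : LinearIndependent L fun a ↦ (⟨_, hmem a⟩ : LinearMap.ker φ) :=
    .of_comp (LinearMap.ker φ).subtype hind
  have := hind'.fintype_card_le_finrank
  rw [Fintype.card_fin] at this
  lia

/-- Let `ψ : P^m ⇢ P^n` be the rational map defined by forms `f₀,…,f_n` of the same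
degree `d`, defined on the complement `Ω` of its base locus.  Let `V ⊆ P^m` be an
irreducible subvariety (with homogeneous prime ideal `P`) with `V ∩ Ω ≠ ∅`, and let
`r = dim V − dim ψ(V)` (where `ψ(V)`, the closure of the image of `V ∩ Ω`, has prime
ideal `Q = {g : g(f) ∈ P}`).  Then `V ⊆ V(I_{m−r+2}(J(f)))`. -/
theorem stmt17 (f : Fin (n + 1) → MvPolynomial (Fin (m + 1)) k)
    (hhom : ∀ i, (f i).IsHomogeneous d)
    (P : Ideal (MvPolynomial (Fin (m + 1)) k)) (hP : P.IsPrime)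
    (hPhom : Ideal.IsHomogeneous (homogeneousSubmodule (Fin (m + 1)) k) P)
    -- `V ∩ Ω ≠ ∅` : `V` is not contained in the base locus of `ψ`
    (hΩ : ¬ (Ideal.span (Set.range f) ≤ P))
    (dV dW : ℕ) (hdW : dW ≤ dV)
    -- `dim V = dV` (so the affine cone over `V` has dimension `dV + 1`)
    (hdV : ringKrullDim (MvPolynomial (Fin (m + 1)) k ⧸ P) = (dV + 1 : ℕ))
    -- `dim ψ(V) = dW`
    (hdWdim : ringKrullDim (MvPolynomial (Fin (n + 1)) k ⧸
        Ideal.comap (MvPolynomial.aeval f :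
          MvPolynomial (Fin (n + 1)) k →ₐ[k] MvPolynomial (Fin (m + 1)) k).toRingHom P)
      = (dW + 1 : ℕ)) :
    jacMinors f (m - (dV - dW) + 2) ≤ P := by
  let A := MvPolynomial (Fin (m + 1)) k ⧸ P
  let L := FractionRing A
  let x (j : Fin (m + 1)) : L := algebraMap A L (Ideal.Quotient.mk P (X j))
  have hx_aeval (p : MvPolynomial (Fin (m + 1)) k) :
      aeval x p = algebraMap A L (Ideal.Quotient.mk P p) :=
    (DFunLike.congr_fun
      (aeval_unique ((IsScalarTower.toAlgHom k A L).comp (Ideal.Quotient.mkₐ k P))) p).symm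
  have hx_zero (p : MvPolynomial (Fin (m + 1)) k) : aeval x p = 0 ↔ p ∈ P := by
    rw [hx_aeval, FaithfulSMul.algebraMap_eq_zero_iff, Ideal.Quotient.eq_zero_iff_mem]
  have hx : IntermediateField.adjoin k (Set.range x) = ⊤ := by
    rw [← top_le_iff]
    intro z _
    obtain ⟨a, b, -, rfl⟩ := IsFractionRing.div_surjective (A := A) z
    obtain ⟨p, rfl⟩ := Ideal.Quotient.mk_surjective a
    obtain ⟨q, rfl⟩ := Ideal.Quotient.mk_surjective b
    rw [IntermediateField.mem_adjoin_range_iff]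
    exact ⟨p, q, by rw [hx_aeval, hx_aeval]⟩
  let y (i : Fin (n + 1)) : L := aeval x (f i)
  let B := Algebra.adjoin k (Set.range y)
  have hB : ringKrullDim B = (dW + 1 : ℕ) := by
    have hy : aeval y = (aeval x).comp (aeval f) := by
      ext i
      simp [y]
    have hker : Ideal.comap (aeval f :
        MvPolynomial (Fin (n + 1)) k →ₐ[k] MvPolynomial (Fin (m + 1)) k).toRingHom P =
        RingHom.ker (aeval y : MvPolynomial (Fin (n + 1)) k →ₐ[k] L) := by
      ext p
      rw [RingHom.mem_ker, hy, AlgHom.comp_apply, hx_zero]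
      rfl
    have hrange : B = (aeval y : MvPolynomial (Fin (n + 1)) k →ₐ[k] L).range :=
      Algebra.adjoin_range_eq_range_aeval k y
    rw [← hdWdim, hker, hrange]
    exact (ringKrullDim_eq_of_ringEquiv (Ideal.quotientKerEquivRange
      (aeval y : MvPolynomial (Fin (n + 1)) k →ₐ[k] L)).toRingEquiv).symm
  have hkL : Algebra.trdeg k L = (dV + 1 : ℕ) := by
    have : Algebra.IsAlgebraic A L := IsLocalization.isAlgebraic L (nonZeroDivisors A)
    rw [← trdeg_add_eq k A (A := L), trdeg_eq_of_ringKrullDim_eq k A hdV, trdeg_eq_zero, add_zero]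
  have hr := natCast_sub_le_trdeg_adjoin hkL hB
  refine Ideal.span_le.mpr ?_
  rintro _ ⟨g, h, rfl⟩
  rw [SetLike.mem_coe, ← hx_zero, AlgHom.map_det]
  exact det_jacobian_submatrix_eq_zero hx f hr (by rw [Fintype.card_fin]; lia) g h
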